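/- Let ℓ > 0, d ≥ 1 and R > 0, and consider the isotropic Gaussian kernel on ℝ^d with length-scale ℓ in every coordinate. There exist positive constants C and h₀, depending only on ℓ, d and R, such that for every closed cube Ω ⊂ ℝ^d with side length R and every finite set X ⊂ ℝ^d of distinct points with X ∩ Ω ≠ ∅ and h_{X,Ω} ≤ h₀, the power function satisfies ∫_Ω P_{ℓ,X}(x) dx ≤ exp(C log(h_{X,Ω}) / h_{X,Ω}). -/

import Mathlib

open MeasureTheory Real Filter

noncomputable section

/-- The orthonormal basis functions of the Gaussian RKHS. -/
def phi (ℓ : ℝ) (m : ℕ) (x : ℝ) : ℝ :=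
  x ^ m * Real.exp (-x ^ 2 / (2 * ℓ ^ 2)) / (ℓ ^ m * Real.sqrt (Nat.factorial m))

/-- The univariate Gaussian integral functional. -/
def Igauss (α : ℝ) (f : ℝ → ℝ) : ℝ :=
  (Real.sqrt (2 * Real.pi) * α)⁻¹ * ∫ x : ℝ, f x * Real.exp (-x ^ 2 / (2 * α ^ 2))

/-- β = αℓ/√(α² + ℓ²). -/
def betaP (α ℓ : ℝ) : ℝ := α * ℓ / Real.sqrt (α ^ 2 + ℓ ^ 2)

/-- C_n = 2^n n! n^{−1/4} / √((2n)!). -/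
def Cseq (n : ℕ) : ℝ :=
  2 ^ n * (Nat.factorial n : ℝ) * (n : ℝ) ^ (-(1 / 4 : ℝ)) / Real.sqrt (Nat.factorial (2 * n))

/-- ω_γ = 2γ²/(1 + 2γ² + √(1+4γ²)). -/
def omegaP (γ : ℝ) : ℝ := 2 * γ ^ 2 / (1 + 2 * γ ^ 2 + Real.sqrt (1 + 4 * γ ^ 2))

/-- C̄_n(γ). -/
def Cbar (γ : ℝ) (n : ℕ) : ℝ :=
  Real.sqrt (2 * (1 + 4 * γ ^ 2) ^ ((1 : ℝ) / 4) /
      ((1 + 2 * γ ^ 2 + Real.sqrt (1 + 4 * γ ^ 2)) * Real.exp 1)) *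
    ((Nat.factorial n : ℝ) / (Nat.factorial (2 * n) : ℝ)) *
    (Real.exp 1 / (4 * (n : ℝ))) ^ (-(n : ℤ))

/-- `x`, `w` are the nodes and weights of the n-point Gauss–Hermite rule: the nodes are the
n distinct roots of the probabilists' Hermite polynomial H_n, the weights are positive, and
the rule integrates exactly all polynomials of degree at most 2n−1 against the standard
Gaussian weight. -/
def IsGaussHermite (n : ℕ) (x w : Fin n → ℝ) : Prop :=
  Function.Injective x ∧
  (∀ i, Polynomial.aeval (x i) (Polynomial.hermite n) = 0) ∧
  (∀ i, 0 < w i) ∧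
  ∀ p : Polynomial ℝ, p.natDegree ≤ 2 * n - 1 →
    ∑ i, w i * p.eval (x i)
      = (Real.sqrt (2 * Real.pi))⁻¹ * ∫ t : ℝ, p.eval t * Real.exp (-t ^ 2 / 2)

/-- The scaled Gauss–Hermite rule Q_{α,ℓ,n}^{GH}. -/
def QGH (α ℓ : ℝ) {n : ℕ} (x w : Fin n → ℝ) (f : ℝ → ℝ) : ℝ :=
  betaP α ℓ / α *
    ∑ i, w i * Real.exp (betaP α ℓ ^ 2 * x i ^ 2 / (2 * ℓ ^ 2)) * f (betaP α ℓ * x i)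

/-- Membership in the unit ball of the Gaussian RKHS H(K_ℓ). -/
def InBall (ℓ : ℝ) (f : ℝ → ℝ) : Prop :=
  ∃ c : ℕ → ℝ, (∀ x, HasSum (fun m => c m * phi ℓ m x) (f x)) ∧
    Summable (fun m => c m ^ 2) ∧ (∑' m, c m ^ 2) ≤ 1

/-- Worst-case error of a quadrature functional over the unit ball of H(K_ℓ). -/
def wce1 (α ℓ : ℝ) (Q : (ℝ → ℝ) → ℝ) : ℝ :=
  sSup {e : ℝ | ∃ f : ℝ → ℝ, InBall ℓ f ∧ e = |Igauss α f - Q f|}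

/-- The n-th minimal worst-case error (univariate). -/
def minErr1 (α ℓ : ℝ) (n : ℕ) : ℝ :=
  ⨅ p : (Fin n → ℝ) × (Fin n → ℝ), wce1 α ℓ fun f => ∑ i, p.2 i * f (p.1 i)

/-- The multivariate Gaussian integral functional. -/
def IgaussD {d : ℕ} (α : Fin d → ℝ) (f : (Fin d → ℝ) → ℝ) : ℝ :=
  ∫ x : Fin d → ℝ,
    f x * ∏ i, (Real.sqrt (2 * Real.pi) * α i)⁻¹ * Real.exp (-(x i) ^ 2 / (2 * α i ^ 2))

/-- Membership in the unit ball of the tensor-product Gaussian RKHS H(K_ℓ), ℓ ∈ ℝ^d. -/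
def InBallD {d : ℕ} (ℓ : Fin d → ℝ) (f : (Fin d → ℝ) → ℝ) : Prop :=
  ∃ c : (Fin d → ℕ) → ℝ,
    (∀ x, HasSum (fun m => c m * ∏ i, phi (ℓ i) (m i) (x i)) (f x)) ∧
    Summable (fun m => c m ^ 2) ∧ (∑' m, c m ^ 2) ≤ 1

/-- Worst-case error of a multivariate quadrature functional. -/
def wceD {d : ℕ} (α ℓ : Fin d → ℝ) (Q : ((Fin d → ℝ) → ℝ) → ℝ) : ℝ :=
  sSup {e : ℝ | ∃ f, InBallD ℓ f ∧ e = |IgaussD α f - Q f|}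

/-- The N-th minimal worst-case error in dimension d. -/
def minErrD {d : ℕ} (α ℓ : Fin d → ℝ) (N : ℕ) : ℝ :=
  ⨅ p : (Fin N → (Fin d → ℝ)) × (Fin N → ℝ), wceD α ℓ fun f => ∑ i, p.2 i * f (p.1 i)

/-- The tensor-product scaled Gauss–Hermite rule. -/
def QGHD {d : ℕ} (α ℓ : Fin d → ℝ) (n : Fin d → ℕ)
    (x w : ∀ j, Fin (n j) → ℝ) (f : (Fin d → ℝ) → ℝ) : ℝ :=
  ∑ i : ∀ j, Fin (n j),
    (∏ j, betaP (α j) (ℓ j) / α j * w j (i j) *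
        Real.exp (betaP (α j) (ℓ j) ^ 2 * x j (i j) ^ 2 / (2 * ℓ j ^ 2))) *
      f fun j => betaP (α j) (ℓ j) * x j (i j)

/-- The power function of a finite point set (univariate). -/
def power1 (ℓ : ℝ) (X : Finset ℝ) (x : ℝ) : ℝ :=
  sSup {v : ℝ | ∃ f, InBall ℓ f ∧ (∀ y ∈ X, f y = 0) ∧ v = f x}

/-- Fill distance of X on Ω (univariate). -/
def fillDist1 (X : Finset ℝ) (Ω : Set ℝ) : ℝ :=
  sSup {h : ℝ | ∃ x ∈ Ω, h = sInf {r : ℝ | ∃ y ∈ X, y ∈ Ω ∧ r = |x - y|}}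

/-- Euclidean distance on ℝ^d. -/
def eucDist {d : ℕ} (x y : Fin d → ℝ) : ℝ := Real.sqrt (∑ i, (x i - y i) ^ 2)

/-- The power function of a finite point set in ℝ^d for the isotropic Gaussian kernel. -/
def powerD {d : ℕ} (ℓ : ℝ) (X : Finset (Fin d → ℝ)) (x : Fin d → ℝ) : ℝ :=
  sSup {v : ℝ | ∃ f, InBallD (fun _ => ℓ) f ∧ (∀ y ∈ X, f y = 0) ∧ v = f x}

/-- Fill distance of X on Ω ⊂ ℝ^d (Euclidean). -/
def fillDistD {d : ℕ} (X : Finset (Fin d → ℝ)) (Ω : Set (Fin d → ℝ)) : ℝ :=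
  sSup {h : ℝ | ∃ x ∈ Ω, h = sInf {r : ℝ | ∃ y ∈ X, y ∈ Ω ∧ r = eucDist x y}}

/-- Worst-case error of the optimal-weight (kernel quadrature) rule with nodes X (univariate). -/
def eopt1 (α ℓ : ℝ) (X : Finset ℝ) : ℝ :=
  ⨅ w : ℝ → ℝ, wce1 α ℓ fun f => ∑ y ∈ X, w y * f y

/-- Worst-case error of the optimal-weight rule with nodes X ⊂ ℝ^d. -/
def eoptD {d : ℕ} (α ℓ : Fin d → ℝ) (X : Finset (Fin d → ℝ)) : ℝ :=
  ⨅ w : (Fin d → ℝ) → ℝ, wceD α ℓ fun f => ∑ y ∈ X, w y * f y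

/-- The point sets X_k = ∪_{m=1}^k (Y_{k−m+1}^{m,+} ∪ Y_{k−m+1}^{m,−}). -/
def Xk (Y : ℕ → Finset ℝ) (k : ℕ) : Finset ℝ :=
  (Finset.Icc 1 k).biUnion fun m =>
    ((Y (k - m + 1)).image fun x => x + (m : ℝ) - 1) ∪
      ((Y (k - m + 1)).image fun x => x - (m : ℝ))

open Polynomial in
/-- Bernstein–Walsh growth estimate in Joukowski coordinates. -/
theorem norm_aeval_joukowski_le {N : ℕ} {P : ℝ[X]} {M : ℝ} (hN : P.natDegree ≤ N)
    (hM : ∀ x ∈ Set.Icc (-1 : ℝ) 1, |P.eval x| ≤ M) {ζ : ℂ} (h0 : ζ ≠ 0) (h1 : ‖ζ‖ ≤ 1) :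
    ‖aeval ((ζ + ζ⁻¹) / 2) P‖ ≤ M * (‖ζ‖⁻¹) ^ N := by
  set Q : ℂ → ℂ := fun z => ∑ k ∈ Finset.range (N + 1),
    (P.coeff k : ℂ) * (z ^ (N - k) * ((z ^ 2 + 1) / 2) ^ k) with hQ
  have key : ∀ z : ℂ, z ≠ 0 → Q z = z ^ N * aeval ((z + z⁻¹) / 2) P := by
    intro z hz
    rw [aeval_eq_sum_range' (Nat.lt_succ_of_le hN), Finset.mul_sum]
    refine Finset.sum_congr rfl fun k hk => ?_
    have hk' : k ≤ N := Nat.lt_succ_iff.1 (Finset.mem_range.1 hk)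
    have h2 : (z ^ 2 + 1) / 2 = z * ((z + z⁻¹) / 2) := by field_simp
    rw [h2, mul_pow, ← mul_assoc (z ^ (N - k)), ← pow_add, Nat.sub_add_cancel hk',
      Complex.real_smul]
    ring
  have hdiff : Differentiable ℂ Q := by
    rw [hQ]; fun_prop
  have hbd : ∀ z ∈ frontier (Metric.ball (0 : ℂ) 1), ‖Q z‖ ≤ M := by
    intro z hz
    rw [frontier_ball _ one_ne_zero, mem_sphere_zero_iff_norm] at hz
    have hz0 : z ≠ 0 := by
      rintro rfl; simp at hz
    have hinv : (z + z⁻¹) / 2 = ((z.re : ℝ) : ℂ) := by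
      rw [Complex.inv_eq_conj hz, Complex.add_conj]; push_cast; ring
    rw [key z hz0, norm_mul, norm_pow, hz, one_pow, one_mul, hinv,
      ← Complex.coe_algebraMap, aeval_algebraMap_apply, Complex.coe_algebraMap,
      Complex.norm_real, coe_aeval_eq_eval, Real.norm_eq_abs]
    refine hM _ (abs_le.1 ?_)
    rw [← hz]; exact Complex.abs_re_le_norm z
  have hmem : ζ ∈ closure (Metric.ball (0 : ℂ) 1) := by
    rw [closure_ball _ one_ne_zero]; simpa using h1
  have := Complex.norm_le_of_forall_mem_frontier_norm_le Metric.isBounded_ball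
    hdiff.diffContOnCl hbd hmem
  rw [key ζ h0, norm_mul, norm_pow] at this
  have hpos : 0 < ‖ζ‖ ^ N := by positivity
  rw [inv_pow, ← div_eq_mul_inv, le_div_iff₀ hpos, mul_comm]
  exact this

theorem exists_joukowski (w : ℂ) : ∃ z : ℂ, Complex.cos z = w ∧ 0 ≤ z.im := by
  obtain ⟨z, hz⟩ := Complex.cos_surjective w
  rcases le_total 0 z.im with h | h
  · exact ⟨z, hz, h⟩
  · exact ⟨-z, by rw [Complex.cos_neg, hz], by simpa using h⟩

open Polynomial in
theorem norm_aeval_cos_le {N : ℕ} {P : ℝ[X]} {M : ℝ} (hN : P.natDegree ≤ N)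
    (hM : ∀ x ∈ Set.Icc (-1 : ℝ) 1, |P.eval x| ≤ M) (z : ℂ) :
    ‖aeval (Complex.cos z) P‖ ≤ M * Real.exp (N * |z.im|) := by
  wlog h : 0 ≤ z.im generalizing z
  · have := this (-z) (by simp; linarith)
    simpa using this
  have := norm_aeval_joukowski_le hN hM (ζ := Complex.exp (z * Complex.I))
    (Complex.exp_ne_zero _) (by rw [Complex.norm_exp]; simpa using h)
  rw [← Complex.exp_neg, ← neg_mul] at this
  rw [Complex.cos]
  refine this.trans_eq ?_
  rw [Complex.norm_exp, ← Real.exp_neg, ← Real.exp_nat_mul]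
  simp [abs_of_nonneg h]

open Polynomial in
theorem abs_eval_le_of_half_interval {N : ℕ} {P : ℝ[X]} {M : ℝ} (hN : P.natDegree ≤ N)
    (hM : ∀ x : ℝ, |x| ≤ 1 / 2 → |P.eval x| ≤ M) {x : ℝ} (hx : |x| ≤ 1) :
    |P.eval x| ≤ 5 ^ N * M := by
  have hM0 : 0 ≤ M := (abs_nonneg _).trans (hM 0 (by simp))
  set P' : ℝ[X] := P.comp (C (1 / 2) * X) with hP'
  have hN' : P'.natDegree ≤ N := by
    refine (natDegree_comp_le).trans ?_
    calc P.natDegree * (C (1 / 2 : ℝ) * X).natDegree ≤ P.natDegree * 1 :=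
          Nat.mul_le_mul_left _ ((natDegree_C_mul_le _ _).trans natDegree_X_le)
      _ ≤ N := by simpa using hN
  have hM' : ∀ t ∈ Set.Icc (-1 : ℝ) 1, |P'.eval t| ≤ M := by
    intro t ht
    simp only [hP', eval_comp, eval_mul, eval_C, eval_X]
    apply hM
    rw [abs_mul, abs_of_pos (by norm_num : (0 : ℝ) < 1 / 2)]
    have := abs_le.2 ht
    linarith
  obtain ⟨z, hz, him⟩ := exists_joukowski ((2 * x : ℝ) : ℂ)
  set ζ := Complex.exp (z * Complex.I) with hζ
  have h0 : ζ ≠ 0 := Complex.exp_ne_zero _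
  have h1 : ‖ζ‖ ≤ 1 := by rw [hζ, Complex.norm_exp]; simpa using him
  have hw : (ζ + ζ⁻¹) / 2 = ((2 * x : ℝ) : ℂ) := by
    rw [← hz, Complex.cos, hζ, ← Complex.exp_neg, ← neg_mul]
  have hinv : ‖ζ‖⁻¹ ≤ 5 := by
    have : ζ⁻¹ = 2 * ((2 * x : ℝ) : ℂ) - ζ := by rw [← hw]; ring
    rw [← norm_inv, this]
    refine (norm_sub_le _ _).trans ?_
    rw [norm_mul, Complex.norm_real, Real.norm_eq_abs, abs_mul]
    norm_num
    linarith
  have := norm_aeval_joukowski_le hN' hM' h0 h1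
  rw [hw, ← Complex.coe_algebraMap, aeval_algebraMap_apply, Complex.coe_algebraMap,
      Complex.norm_real, coe_aeval_eq_eval, Real.norm_eq_abs, hP'] at this
  simp only [eval_comp, eval_mul, eval_C, eval_X] at this
  rw [show 1 / 2 * (2 * x) = x by ring] at this
  refine this.trans ?_
  rw [mul_comm]
  gcongr

open Polynomial in
/-- A Bernstein inequality with non-optimal constant. -/
theorem abs_eval_cos_sub_le {N : ℕ} {P : ℝ[X]} {M : ℝ} (hN : P.natDegree ≤ N)
    (hM : ∀ x ∈ Set.Icc (-1 : ℝ) 1, |P.eval x| ≤ M) (hN0 : 0 < N) (s t : ℝ) :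
    |P.eval (Real.cos s) - P.eval (Real.cos t)| ≤ 3 * N * M * |s - t| := by
  have hM0 : 0 ≤ M := (abs_nonneg _).trans (hM 0 (by simp))
  have hNR : (0 : ℝ) < N := by exact_mod_cast hN0
  set f : ℂ → ℂ := fun z => aeval (Complex.cos z) P with hf
  have hd : Differentiable ℂ f := by
    have := (P.map (algebraMap ℝ ℂ)).differentiable.comp Complex.differentiable_cos
    simpa [Function.comp_def, hf] using this
  have hder : ∀ z ∈ {z : ℂ | z.im = 0}, ‖deriv f z‖ ≤ 3 * N * M := by
    intro z hz
    have hC : ∀ w ∈ Metric.sphere z (1 / (N : ℝ)), ‖f w‖ ≤ 3 * M := by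
      intro w hw
      refine (norm_aeval_cos_le hN hM w).trans ?_
      have him : |w.im| ≤ 1 / N := by
        have h1 := Complex.abs_im_le_norm (w - z)
        rw [Complex.sub_im, show z.im = 0 from hz, sub_zero] at h1
        rw [mem_sphere_iff_norm] at hw
        exact h1.trans_eq hw
      have h2 : (N : ℝ) * |w.im| ≤ 1 := by
        calc (N : ℝ) * |w.im| ≤ N * (1 / N) := by gcongr
          _ = 1 := by field_simp
      have h3 : Real.exp (N * |w.im|) ≤ 3 :=
        (Real.exp_le_exp.2 h2).trans (by have := Real.exp_one_lt_d9; linarith)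
      rw [mul_comm]
      gcongr
    have := Complex.norm_deriv_le_of_forall_mem_sphere_norm_le (by positivity)
      hd.diffContOnCl hC
    refine this.trans_eq ?_
    field_simp
  have hconv : Convex ℝ {z : ℂ | z.im = 0} := by
    intro x hx y hy a b _ _ _
    simp only [Set.mem_ofPred_eq] at hx hy ⊢
    simp [hx, hy]
  have := hconv.norm_image_sub_le_of_norm_deriv_le (fun x _ => hd x) hder
    (x := (t : ℂ)) (y := (s : ℂ)) (by simp) (by simp)
  have hre : ∀ r : ℝ, f r = ((P.eval (Real.cos r) : ℝ) : ℂ) := by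
    intro r
    simp only [hf]
    rw [← Complex.ofReal_cos, ← Complex.coe_algebraMap, aeval_algebraMap_apply,
      coe_aeval_eq_eval]
  rw [hre, hre, ← Complex.ofReal_sub, ← Complex.ofReal_sub, Complex.norm_real,
    Complex.norm_real] at this
  exact this

theorem abs_arccos_sub_le {r : ℝ} (hr : r < 1) {x y : ℝ} (hx : |x| ≤ r) (hy : |y| ≤ r) :
    |Real.arccos x - Real.arccos y| ≤ 1 / Real.sqrt (1 - r ^ 2) * |x - y| := by
  have hr0 : 0 ≤ r := (abs_nonneg _).trans hx
  have h1 : ∀ t ∈ Set.Icc (-r) r, DifferentiableAt ℝ Real.arccos t := by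
    intro t ht
    exact (Real.hasDerivAt_arccos (by linarith [ht.1]) (by linarith [ht.2])).differentiableAt
  have h2 : ∀ t ∈ Set.Icc (-r) r, ‖deriv Real.arccos t‖ ≤ 1 / Real.sqrt (1 - r ^ 2) := by
    intro t ht
    have hpos : 0 < 1 - r ^ 2 := by nlinarith
    rw [Real.deriv_arccos, norm_neg, Real.norm_of_nonneg (by positivity)]
    have : t ^ 2 ≤ r ^ 2 := sq_le_sq' ht.1 ht.2
    gcongr
  exact (convex_Icc (-r) r).norm_image_sub_le_of_norm_deriv_le h1 h2 (abs_le.1 hy) (abs_le.1 hx)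

open Polynomial in
theorem abs_eval_sub_le {N : ℕ} {P : ℝ[X]} {M r : ℝ} (hN : P.natDegree ≤ N)
    (hM : ∀ x ∈ Set.Icc (-1 : ℝ) 1, |P.eval x| ≤ M) (hN0 : 0 < N) (hr : r < 1)
    {x y : ℝ} (hx : |x| ≤ r) (hy : |y| ≤ r) :
    |P.eval x - P.eval y| ≤ 3 * N * M * (1 / Real.sqrt (1 - r ^ 2)) * |x - y| := by
  have hM0 : 0 ≤ M := (abs_nonneg _).trans (hM 0 (by simp))
  have hx' := abs_le.1 (hx.trans hr.le)
  have hy' := abs_le.1 (hy.trans hr.le)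
  have := abs_eval_cos_sub_le hN hM hN0 (Real.arccos x) (Real.arccos y)
  rw [Real.cos_arccos hx'.1 hx'.2, Real.cos_arccos hy'.1 hy'.2] at this
  refine this.trans ?_
  rw [mul_assoc _ (1 / _)]
  gcongr
  exact abs_arccos_sub_le hr hx hy

/-- `p` is a polynomial of degree at most `N` in each coordinate separately. -/
def IsCoordPoly {d : ℕ} (N : ℕ) (p : (Fin d → ℝ) → ℝ) : Prop :=
  ∀ (i : Fin d) (x : Fin d → ℝ), ∃ P : Polynomial ℝ, P.natDegree ≤ N ∧
    ∀ t : ℝ, p (Function.update x i t) = P.eval t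

theorem IsCoordPoly.abs_le_of_half_cube {d N : ℕ} {p : (Fin d → ℝ) → ℝ} (hp : IsCoordPoly N p)
    {M : ℝ} (hM : ∀ x : Fin d → ℝ, (∀ i, |x i| ≤ 1 / 2) → |p x| ≤ M)
    {x : Fin d → ℝ} (hx : ∀ i, |x i| ≤ 1) : |p x| ≤ (5 ^ d) ^ N * M := by
  have key : ∀ s : Finset (Fin d), ∀ x : Fin d → ℝ, (∀ i ∈ s, |x i| ≤ 1) →
      (∀ i, i ∉ s → |x i| ≤ 1 / 2) → |p x| ≤ (5 ^ s.card) ^ N * M := by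
    intro s
    induction s using Finset.induction_on with
    | empty => intro x _ h; simpa using hM x fun i => h i (by simp)
    | insert j s hj ih =>
      intro x h1 h2
      obtain ⟨P, hP, hPe⟩ := hp j x
      have hb : ∀ t : ℝ, |t| ≤ 1 / 2 → |P.eval t| ≤ (5 ^ s.card) ^ N * M := by
        intro t ht
        rw [← hPe]
        refine ih _ (fun i hi => ?_) (fun i hi => ?_)
        · rw [Function.update_of_ne (by rintro rfl; exact hj hi)]
          exact h1 i (Finset.mem_insert_of_mem hi)
        · rcases eq_or_ne i j with rfl | hij
          · simpa using ht
          · rw [Function.update_of_ne hij]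
            exact h2 i (by simp [hij, hi])
      have := abs_eval_le_of_half_interval hP hb (h1 j (Finset.mem_insert_self _ _))
      rw [← hPe, Function.update_eq_self] at this
      rw [Finset.card_insert_of_notMem hj, pow_succ, mul_pow]
      linarith
  simpa using key Finset.univ x (fun i _ => hx i) (by simp)

theorem IsCoordPoly.abs_sub_le {d N : ℕ} {p : (Fin d → ℝ) → ℝ} (hp : IsCoordPoly N p)
    (hN0 : 0 < N) {M r : ℝ} (hr : r < 1)
    (hM : ∀ x : Fin d → ℝ, (∀ i, |x i| ≤ 1) → |p x| ≤ M)
    {x y : Fin d → ℝ} (hx : ∀ i, |x i| ≤ r) (hy : ∀ i, |y i| ≤ r) :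
    |p x - p y| ≤ 3 * N * M * (1 / Real.sqrt (1 - r ^ 2)) * ∑ i, |x i - y i| := by
  have key : ∀ s : Finset (Fin d), |p x - p (s.piecewise y x)| ≤
      3 * N * M * (1 / Real.sqrt (1 - r ^ 2)) * ∑ i ∈ s, |x i - y i| := by
    intro s
    induction s using Finset.induction_on with
    | empty => simp
    | insert j s hj ih =>
      set z := s.piecewise y x with hz
      have hzr : ∀ i, |z i| ≤ r := by
        intro i
        by_cases hi : i ∈ s <;> simp [hz, hi, hx, hy]
      have hzj : z j = x j := by simp [hz, hj]
      obtain ⟨P, hP, hPe⟩ := hp j z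
      have hb : ∀ t ∈ Set.Icc (-1 : ℝ) 1, |P.eval t| ≤ M := by
        intro t ht
        rw [← hPe]
        refine hM _ fun i => ?_
        rcases eq_or_ne i j with rfl | hij
        · simpa using abs_le.2 ht
        · rw [Function.update_of_ne hij]; exact (hzr i).trans hr.le
      have := abs_eval_sub_le hP hb hN0 hr (hx j) (hy j)
      rw [← hPe, ← hPe, ← hzj, Function.update_eq_self, hzj] at this
      rw [Finset.piecewise_insert, Finset.sum_insert hj, mul_add]
      have h3 := _root_.abs_sub_le (p x) (p z) (p (Function.update z j (y j)))
      linarith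
  simpa using key Finset.univ

theorem IsCoordPoly.mul_weight {d N : ℕ} {p : (Fin d → ℝ) → ℝ} (hp : IsCoordPoly N p) :
    IsCoordPoly (N + 2 * N) fun x => p x * (∏ i, (1 - x i ^ 2)) ^ N := by
  intro i x
  obtain ⟨P, hP, hPe⟩ := hp i x
  refine ⟨P * (Polynomial.C (∏ k ∈ Finset.univ.erase i, (1 - x k ^ 2)) *
    (1 - Polynomial.X ^ 2)) ^ N, ?_, fun t => ?_⟩
  · refine Polynomial.natDegree_mul_le.trans (add_le_add hP ?_)
    refine Polynomial.natDegree_pow_le.trans ?_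
    rw [mul_comm]
    refine Nat.mul_le_mul_right _ ((Polynomial.natDegree_C_mul_le _ _).trans ?_)
    refine (Polynomial.natDegree_sub_le _ _).trans ?_
    simp
  · beta_reduce
    rw [← Finset.mul_prod_erase _ _ (Finset.mem_univ i), hPe]
    have : ∏ k ∈ Finset.univ.erase i, (1 - Function.update x i t k ^ 2) =
        ∏ k ∈ Finset.univ.erase i, (1 - x k ^ 2) :=
      Finset.prod_congr rfl fun k hk => by rw [Function.update_of_ne (Finset.ne_of_mem_erase hk)]
    rw [this]
    simp [mul_comm, Polynomial.eval_prod]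

/-- Scattered points of density comparable to `1/N` form a norming set for polynomials of
coordinate degree at most `N`, with a constant growing exponentially in `N`. -/
theorem exists_norming_constant (d : ℕ) :
    ∃ c : ℝ, 0 < c ∧ ∀ (N : ℕ) (p : (Fin d → ℝ) → ℝ) (Y : Set (Fin d → ℝ)) (δ τ : ℝ),
      0 < N → IsCoordPoly N p → Continuous p → δ * N ≤ c →
      (∀ x : Fin d → ℝ, (∀ i, |x i| ≤ 1) → ∃ y ∈ Y, ∀ i, |x i - y i| ≤ δ) →
      (∀ y ∈ Y, |p y| ≤ τ) →
      ∀ x : Fin d → ℝ, (∀ i, |x i| ≤ 1) → |p x| ≤ 2 * (7 ^ d) ^ N * τ := by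
  -- Maximize `|p|` times a weight vanishing on the boundary of the cube. The weighted maximum
  -- is attained well inside the cube, where Bernstein's inequality has constants of order `N`.
  set a : ℝ := 1 / (2 * 7 ^ d) with ha
  have ha0 : 0 < a := by positivity
  have ha1 : a ≤ 1 / 2 := by
    rw [ha]; gcongr; nlinarith [one_le_pow₀ (by norm_num : (1 : ℝ) ≤ 7) (n := d)]
  set K : ℝ := 9 * (1 / Real.sqrt (1 - (1 - a / 2) ^ 2)) * (d + 1) with hK
  have hsq : 0 < 1 - (1 - a / 2) ^ 2 := by nlinarith
  have hK0 : 0 < K := by positivity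
  refine ⟨min (a / 2) (1 / (2 * K)), by positivity, ?_⟩
  intro N p Y δ τ hN hp hcont hδ hY hτ
  set Q : Set (Fin d → ℝ) := Set.Icc (fun _ => -1) (fun _ => 1) with hQ
  have memQ : ∀ x : Fin d → ℝ, x ∈ Q ↔ ∀ i, |x i| ≤ 1 := by
    intro x
    simp only [hQ, Set.mem_Icc, Pi.le_def, abs_le]
    exact ⟨fun h i => ⟨h.1 i, h.2 i⟩, fun h => ⟨fun i => (h i).1, fun i => (h i).2⟩⟩
  have hQc : IsCompact Q := isCompact_Icc
  have hQne : Q.Nonempty := ⟨0, (memQ 0).2 (by simp)⟩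
  set w : (Fin d → ℝ) → ℝ := fun x => ∏ i, (1 - x i ^ 2) with hw
  set q : (Fin d → ℝ) → ℝ := fun x => p x * w x ^ N with hq
  have hwc : Continuous w := by rw [hw]; fun_prop
  have hqc : Continuous q := by rw [hq]; fun_prop
  have hq1 : ∀ t : ℝ, |t| ≤ 1 → 0 ≤ 1 - t ^ 2 ∧ 1 - t ^ 2 ≤ 1 := by
    intro t ht
    have := (sq_le_one_iff_abs_le_one t).2 ht
    exact ⟨by linarith, by nlinarith⟩
  have hw1 : ∀ x ∈ Q, 0 ≤ w x ∧ w x ≤ 1 := fun x hx =>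
    ⟨Finset.prod_nonneg fun i _ => (hq1 _ ((memQ x).1 hx i)).1,
      Finset.prod_le_one (fun i _ => (hq1 _ ((memQ x).1 hx i)).1)
        fun i _ => (hq1 _ ((memQ x).1 hx i)).2⟩
  obtain ⟨x₁, hx₁, hmax₁⟩ := hQc.exists_isMaxOn hQne (hcont.abs.continuousOn)
  obtain ⟨x₂, hx₂, hmax₂⟩ := hQc.exists_isMaxOn hQne (hqc.abs.continuousOn)
  set M := |p x₁| with hMdef
  set S := |q x₂| with hSdef
  have hS0 : 0 ≤ S := abs_nonneg _
  have hM0 : 0 ≤ M := abs_nonneg _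
  have hS : ∀ x ∈ Q, |q x| ≤ S := fun x hx => hmax₂ hx
  have hM : ∀ x ∈ Q, |p x| ≤ M := fun x hx => hmax₁ hx
  have hNR : (1 : ℝ) ≤ N := by exact_mod_cast hN
  have hhalf : ∀ x : Fin d → ℝ, (∀ i, |x i| ≤ 1 / 2) → |p x| ≤ ((4 / 3) ^ d) ^ N * S := by
    intro x hx
    have hxQ : x ∈ Q := (memQ x).2 fun i => (hx i).trans (by norm_num)
    have hwx : (3 / 4 : ℝ) ^ d ≤ w x := by
      have : ∏ _i : Fin d, (3 / 4 : ℝ) ≤ w x := by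
        refine Finset.prod_le_prod (fun _ _ => by norm_num) fun i _ => ?_
        have := sq_le_sq' (abs_le.1 (hx i)).1 (abs_le.1 (hx i)).2
        linarith
      simpa only [Finset.prod_const, Finset.card_univ, Fintype.card_fin] using this
    have h1 := hS x hxQ
    have h2 : |q x| = |p x| * w x ^ N := by
      rw [hq, abs_mul, abs_of_nonneg (pow_nonneg (hw1 x hxQ).1 N)]
    have h3 : |p x| * ((3 / 4 : ℝ) ^ d) ^ N ≤ S := by
      refine le_trans ?_ (h2 ▸ h1)
      gcongr
    have h4 : ((4 / 3 : ℝ) ^ d) ^ N * ((3 / 4 : ℝ) ^ d) ^ N = 1 := by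
      rw [← mul_pow, ← mul_pow]; norm_num
    calc |p x| = ((4 / 3 : ℝ) ^ d) ^ N * (|p x| * ((3 / 4 : ℝ) ^ d) ^ N) := by
          linear_combination (-|p x|) * h4
      _ ≤ _ := by gcongr
  have hMS : M ≤ (7 ^ d) ^ N * S := by
    refine (hp.abs_le_of_half_cube hhalf ((memQ _).1 hx₁)).trans ?_
    rw [← mul_assoc, ← mul_pow, ← mul_pow]
    gcongr
    norm_num
  suffices hSτ : S ≤ 2 * τ by
    intro x hx
    calc |p x| ≤ M := hM x ((memQ x).2 hx)
      _ ≤ (7 ^ d) ^ N * S := hMS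
      _ ≤ (7 ^ d) ^ N * (2 * τ) := by gcongr
      _ = _ := by ring
  obtain ⟨y, hyY, hy⟩ := hY x₂ ((memQ _).1 hx₂)
  have hτ0 : 0 ≤ τ := (abs_nonneg _).trans (hτ y hyY)
  rcases hS0.eq_or_lt with h | hSpos
  · rw [← h]; positivity
  have hin : ∀ i, |x₂ i| ≤ 1 - a := by
    intro i
    by_contra! hcon
    have hwle : w x₂ ≤ 1 - x₂ i ^ 2 := by
      rw [hw]
      simp only
      rw [← Finset.mul_prod_erase _ _ (Finset.mem_univ i)]
      refine mul_le_of_le_one_right (hq1 _ ((memQ _).1 hx₂ i)).1 ?_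
      exact Finset.prod_le_one (fun i _ => (hq1 _ ((memQ _).1 hx₂ i)).1)
        fun i _ => (hq1 _ ((memQ _).1 hx₂ i)).2
    have h1 : 1 - x₂ i ^ 2 < 2 * a := by
      rw [← sq_abs]; nlinarith [abs_nonneg (x₂ i)]
    have h2 : w x₂ < 1 / 7 ^ d := by
      refine (hwle.trans_lt h1).trans_eq ?_
      rw [ha]; field_simp
    have h3 : S < S := by
      calc S = |p x₂| * w x₂ ^ N := by
            rw [hSdef, hq, abs_mul, abs_of_nonneg (pow_nonneg (hw1 x₂ hx₂).1 N)]
        _ ≤ ((7 ^ d) ^ N * S) * w x₂ ^ N := by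
            gcongr
            · exact pow_nonneg (hw1 x₂ hx₂).1 N
            · exact (hM x₂ hx₂).trans hMS
        _ < ((7 ^ d) ^ N * S) * (1 / 7 ^ d) ^ N := by
            gcongr
            exact (hw1 x₂ hx₂).1
        _ = S := by
            rw [mul_right_comm, ← mul_pow, mul_one_div_cancel (by positivity)]; simp
    exact lt_irrefl _ h3
  have hδa : ∀ _ : Fin d, δ ≤ a / 2 := by
    intro i
    have hδ0 : 0 ≤ δ := (abs_nonneg _).trans (hy i)
    have := hδ.trans (min_le_left _ _)
    nlinarith
  have hyin : ∀ i, |y i| ≤ 1 - a / 2 := by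
    intro i
    have h1 := hy i
    have h2 := hδa i
    have h3 := hin i
    have h4 := abs_sub_abs_le_abs_sub (y i) (x₂ i)
    rw [abs_sub_comm] at h4
    linarith
  have hlip := hp.mul_weight.abs_sub_le (by omega) (by linarith : 1 - a / 2 < 1)
    (fun x hx => hS x ((memQ x).2 hx)) (fun i => (hin i).trans (by linarith)) hyin
  have hsum : ∑ i, |x₂ i - y i| ≤ d * δ := by
    refine (Finset.sum_le_sum fun i _ => hy i).trans_eq ?_
    simp
  have hhalfS : |q x₂ - q y| ≤ S / 2 := by
    refine hlip.trans ?_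
    have h5 := hδ.trans (min_le_right _ _)
    rcases Nat.eq_zero_or_pos d with hd0 | hd0
    · subst hd0
      simp; positivity
    have hδ0 : 0 ≤ δ := (abs_nonneg _).trans (hy ⟨0, hd0⟩)
    calc 3 * ((N + 2 * N : ℕ) : ℝ) * S * (1 / Real.sqrt (1 - (1 - a / 2) ^ 2)) *
          ∑ i, |x₂ i - y i|
        ≤ 3 * ((N + 2 * N : ℕ) : ℝ) * S * (1 / Real.sqrt (1 - (1 - a / 2) ^ 2)) *
          ((d + 1) * δ) := by
          gcongr
          nlinarith
      _ = K * S * (δ * N) := by rw [hK]; push_cast; ring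
      _ ≤ K * S * (1 / (2 * K)) := by gcongr
      _ = S / 2 := by field_simp
  have hqy : |q y| ≤ τ := by
    have hyQ : y ∈ Q := (memQ y).2 fun i => (hyin i).trans (by linarith)
    rw [hq, abs_mul]
    have h6 : |w y ^ N| ≤ 1 := by
      rw [abs_of_nonneg (pow_nonneg (hw1 y hyQ).1 N)]
      exact pow_le_one₀ (hw1 y hyQ).1 (hw1 y hyQ).2
    calc |p y| * |w y ^ N| ≤ τ * 1 := by
          gcongr
          exact hτ y hyY
      _ = τ := mul_one _
  have := abs_sub_abs_le_abs_sub (q x₂) (q y)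
  linarith

theorem hasSum_pi_prod {d : ℕ} {f : Fin d → ℕ → ℝ} {s : Fin d → ℝ}
    (hf : ∀ i, HasSum (f i) (s i)) :
    HasSum (fun m : Fin d → ℕ => ∏ i, f i (m i)) (∏ i, s i) := by
  induction d with
  | zero => simp
  | succ d ih =>
    have h1 := ih fun i => hf i.succ
    have h2 := (hf 0).mul h1
      (summable_mul_of_summable_norm (f := f 0)
        (g := fun m : Fin d → ℕ => ∏ i : Fin d, f i.succ (m i)) (hf 0).summable.norm h1.summable.norm)
    have h3 : (fun m : Fin (d + 1) → ℕ => ∏ i, f i (m i)) ∘ (Fin.consEquiv fun _ => ℕ) =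
        fun m : ℕ × (Fin d → ℕ) => f 0 m.1 * ∏ i : Fin d, f i.succ (m.2 i) := by
      ext m
      simp [Fin.consEquiv, Fin.prod_univ_succ]
    rw [Fin.prod_univ_succ]
    refine (Equiv.hasSum_iff (Fin.consEquiv fun _ => ℕ)).1 ?_
    rw [h3]
    exact h2

theorem hasSum_prod_pow_div_factorial {d : ℕ} (a : Fin d → ℝ) :
    HasSum (fun m : Fin d → ℕ => ∏ i, a i ^ m i / (m i).factorial) (Real.exp (∑ i, a i)) := by
  rw [Real.exp_sum]
  refine hasSum_pi_prod (f := fun i k => a i ^ k / k.factorial)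
    (s := fun i => Real.exp (a i)) fun i => ?_
  rw [Real.exp_eq_exp_ℝ]
  exact NormedSpace.expSeries_div_hasSum_exp (a i)

theorem phi_mul_phi {ℓ : ℝ} (hℓ : 0 < ℓ) (m : ℕ) (x y : ℝ) :
    phi ℓ m x * phi ℓ m y =
      Real.exp (-x ^ 2 / (2 * ℓ ^ 2)) * Real.exp (-y ^ 2 / (2 * ℓ ^ 2)) *
        ((x * y / ℓ ^ 2) ^ m / m.factorial) := by
  have h : Real.sqrt (m.factorial) * Real.sqrt (m.factorial) = m.factorial :=
    Real.mul_self_sqrt (by positivity)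
  unfold phi
  rw [div_mul_div_comm, div_pow, mul_pow, mul_mul_mul_comm (ℓ ^ m), h]
  field_simp
  ring

/-- The Gaussian kernel is the reproducing kernel of the expansion in the functions `phi`. -/
theorem hasSum_phi_mul_phi {d : ℕ} {ℓ : ℝ} (hℓ : 0 < ℓ) (x y : Fin d → ℝ) :
    HasSum (fun m : Fin d → ℕ => (∏ i, phi ℓ (m i) (x i)) * ∏ i, phi ℓ (m i) (y i))
      (∏ i, Real.exp (-(x i - y i) ^ 2 / (2 * ℓ ^ 2))) := by
  simp_rw [← Finset.prod_mul_distrib, phi_mul_phi hℓ]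
  refine hasSum_pi_prod
    (f := fun i k => Real.exp (-x i ^ 2 / (2 * ℓ ^ 2)) * Real.exp (-y i ^ 2 / (2 * ℓ ^ 2)) *
      ((x i * y i / ℓ ^ 2) ^ k / k.factorial))
    (s := fun i => Real.exp (-(x i - y i) ^ 2 / (2 * ℓ ^ 2))) fun i => ?_
  have h := (NormedSpace.expSeries_div_hasSum_exp (x i * y i / ℓ ^ 2)).mul_left
    (Real.exp (-(x i) ^ 2 / (2 * ℓ ^ 2)) * Real.exp (-(y i) ^ 2 / (2 * ℓ ^ 2)))
  rw [← Real.exp_eq_exp_ℝ] at h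
  have he : -(x i - y i) ^ 2 / (2 * ℓ ^ 2) =
      -(x i) ^ 2 / (2 * ℓ ^ 2) + -(y i) ^ 2 / (2 * ℓ ^ 2) + x i * y i / ℓ ^ 2 := by
    field_simp
    ring
  rw [he, Real.exp_add, Real.exp_add]
  exact h

/-- The canonical feature map of the Gaussian kernel. -/
def gaussFeature {d : ℕ} {ℓ : ℝ} (hℓ : 0 < ℓ) (x : Fin d → ℝ) :
    lp (fun _ : Fin d → ℕ => ℝ) 2 :=
  ⟨fun m => ∏ i, phi ℓ (m i) (x i), by
    refine memℓp_gen ?_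
    have := (hasSum_phi_mul_phi hℓ x x).summable
    simpa only [ENNReal.toReal_ofNat, Real.rpow_ofNat, Real.norm_eq_abs, sq_abs, ← pow_two]
      using this⟩

theorem inner_gaussFeature {d : ℕ} {ℓ : ℝ} (hℓ : 0 < ℓ) (x y : Fin d → ℝ) :
    inner ℝ (gaussFeature hℓ x) (gaussFeature hℓ y) =
      ∏ i, Real.exp (-(x i - y i) ^ 2 / (2 * ℓ ^ 2)) := by
  rw [lp.inner_eq_tsum]
  simpa [gaussFeature, mul_comm] using (hasSum_phi_mul_phi hℓ x y).tsum_eq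

theorem inner_gaussFeature_sub {d : ℕ} {ℓ : ℝ} (hℓ : 0 < ℓ) (a x y : Fin d → ℝ) :
    inner ℝ (gaussFeature hℓ (x - a)) (gaussFeature hℓ (y - a)) =
      inner ℝ (gaussFeature hℓ x) (gaussFeature hℓ y) := by
  simp [inner_gaussFeature]

theorem inBallD_iff {d : ℕ} {ℓ : ℝ} (hℓ : 0 < ℓ) {f : (Fin d → ℝ) → ℝ} :
    InBallD (fun _ => ℓ) f ↔ ∃ c : lp (fun _ : Fin d → ℕ => ℝ) 2, ‖c‖ ≤ 1 ∧
      ∀ x, f x = inner ℝ (gaussFeature hℓ x) c := by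
  have hnorm : ∀ c : lp (fun _ : Fin d → ℕ => ℝ) 2, HasSum (fun m => c m ^ 2) (‖c‖ ^ 2) := by
    intro c
    rw [← real_inner_self_eq_norm_sq]
    simpa [pow_two] using lp.hasSum_inner (𝕜 := ℝ) c c
  have hval : ∀ (c : lp (fun _ : Fin d → ℕ => ℝ) 2) x,
      HasSum (fun m => c m * ∏ i, phi ℓ (m i) (x i)) (inner ℝ (gaussFeature hℓ x) c) :=
    fun c x => by simpa [gaussFeature] using lp.hasSum_inner (𝕜 := ℝ) (gaussFeature hℓ x) c
  constructor
  · rintro ⟨c, hc, hs, hle⟩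
    let c' : lp (fun _ : Fin d → ℕ => ℝ) 2 := ⟨c, memℓp_gen (by simpa using hs)⟩
    refine ⟨c', ?_, fun x => (hc x).unique (hval c' x)⟩
    rw [← sq_le_one_iff₀ (norm_nonneg _), ← (hnorm c').tsum_eq]
    exact hle
  · rintro ⟨c, hc, hf⟩
    refine ⟨c, fun x => hf x ▸ hval c x, (hnorm c).summable, ?_⟩
    rw [(hnorm c).tsum_eq]
    exact (sq_le_one_iff₀ (norm_nonneg _)).2 hc

/-- Restrictions to a finite set of functions in the unit ball may be translated. -/
theorem InBallD.exists_translate {d : ℕ} {ℓ : ℝ} (hℓ : 0 < ℓ) {f : (Fin d → ℝ) → ℝ}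
    (hf : InBallD (fun _ => ℓ) f) (S : Finset (Fin d → ℝ)) (a : Fin d → ℝ) :
    ∃ g, InBallD (fun _ => ℓ) g ∧ ∀ s ∈ S, g (s - a) = f s := by
  obtain ⟨c, hc, hfc⟩ := (inBallD_iff hℓ).1 hf
  set V := Submodule.span ℝ (gaussFeature hℓ '' (S : Set (Fin d → ℝ))) with hV
  have : FiniteDimensional ℝ V :=
    FiniteDimensional.span_of_finite ℝ (S.finite_toSet.image _)
  have hmem : V.starProjection c ∈ V := Submodule.starProjection_apply_mem V c
  obtain ⟨μ, hμ⟩ := (Submodule.mem_span_image_finset_iff_exists_fun ℝ).1 hmem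
  set c' := ∑ s : S, μ s • gaussFeature hℓ ((s : Fin d → ℝ) - a) with hc'
  have hproj : ∀ s ∈ S, inner ℝ (gaussFeature hℓ s) (V.starProjection c) = f s := by
    intro s hs
    rw [hfc, ← Submodule.inner_starProjection_left_eq_right,
      Submodule.starProjection_eq_self_iff.2
        (Submodule.subset_span (Set.mem_image_of_mem _ hs))]
  have hc1 : ‖c'‖ ≤ 1 := by
    have : ‖c'‖ ^ 2 = ‖V.starProjection c‖ ^ 2 := by
      rw [← hμ, ← real_inner_self_eq_norm_sq, ← real_inner_self_eq_norm_sq, hc']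
      simp_rw [sum_inner, inner_sum, inner_smul_left, inner_smul_right, inner_gaussFeature_sub]
    rw [pow_left_inj₀ (norm_nonneg _) (norm_nonneg _) two_ne_zero] at this
    rw [this]
    exact (V.norm_starProjection_apply_le c).trans hc
  refine ⟨fun x => inner ℝ (gaussFeature hℓ x) c', (inBallD_iff hℓ).2 ⟨c', hc1, fun _ => rfl⟩,
    fun s hs => ?_⟩
  rw [← hproj s hs, ← hμ, hc']
  simp_rw [inner_sum, inner_smul_right, inner_gaussFeature_sub]

/-- A function in the unit ball is, up to a Gaussian factor, super-exponentially close to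
polynomials on cubes. -/
theorem InBallD.exists_coordPoly_approx {d : ℕ} {ℓ : ℝ} (hℓ : 0 < ℓ) {f : (Fin d → ℝ) → ℝ}
    (hf : InBallD (fun _ => ℓ) f) {ρ : ℝ} {N : ℕ} (hN : 0 < N) :
    ∃ p : (Fin d → ℝ) → ℝ, IsCoordPoly N p ∧ Continuous p ∧
      ∀ u : Fin d → ℝ, (∀ i, |u i| ≤ ρ) → ∃ W : ℝ, 0 < W ∧ W ≤ 1 ∧
        |f u - W * p u| ≤ W * Real.sqrt ((Real.exp (d * (ρ ^ 2 / ℓ ^ 2)) / N) ^ N) := by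
  obtain ⟨c, hc, hs, hle⟩ := hf
  have hNR : (1 : ℝ) ≤ N := by exact_mod_cast hN
  set ψ : (Fin d → ℕ) → (Fin d → ℝ) → ℝ := fun m u =>
    ∏ i, u i ^ m i / (ℓ ^ m i * Real.sqrt (m i).factorial) with hψ
  set box : Finset (Fin d → ℕ) := Fintype.piFinset fun _ => Finset.range (N + 1) with hbox
  refine ⟨fun u => ∑ m ∈ box, c m * ψ m u, ?_, by fun_prop, ?_⟩
  · intro i x
    refine ⟨∑ m ∈ box, Polynomial.C (c m * ((∏ k ∈ Finset.univ.erase i,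
      x k ^ m k / (ℓ ^ m k * Real.sqrt (m k).factorial)) /
        (ℓ ^ m i * Real.sqrt (m i).factorial))) * Polynomial.X ^ m i, ?_, fun t => ?_⟩
    · refine Polynomial.natDegree_sum_le_of_forall_le _ _ fun m hm => ?_
      refine (Polynomial.natDegree_C_mul_X_pow_le _ _).trans ?_
      have := Fintype.mem_piFinset.1 hm i
      exact Nat.lt_succ_iff.1 (Finset.mem_range.1 this)
    · rw [Polynomial.eval_finsetSum]
      refine Finset.sum_congr rfl fun m _ => ?_
      simp only [hψ]
      rw [← Finset.mul_prod_erase _ _ (Finset.mem_univ i)]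
      have : ∏ k ∈ Finset.univ.erase i,
          Function.update x i t k ^ m k / (ℓ ^ m k * Real.sqrt (m k).factorial) =
          ∏ k ∈ Finset.univ.erase i, x k ^ m k / (ℓ ^ m k * Real.sqrt (m k).factorial) :=
        Finset.prod_congr rfl fun k hk => by
          rw [Function.update_of_ne (Finset.ne_of_mem_erase hk)]
      rw [this]
      simp only [Function.update_self, Polynomial.eval_mul, Polynomial.eval_C,
        Polynomial.eval_pow, Polynomial.eval_X]
      ring
  intro u hu
  set W : ℝ := ∏ i, Real.exp (-(u i) ^ 2 / (2 * ℓ ^ 2)) with hW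
  have hW0 : 0 < W := Finset.prod_pos fun i _ => Real.exp_pos _
  have hW1 : W ≤ 1 := by
    refine Finset.prod_le_one (fun i _ => (Real.exp_pos _).le) fun i _ => ?_
    rw [Real.exp_le_one_iff, neg_div]
    exact neg_nonpos.2 (by positivity)
  refine ⟨W, hW0, hW1, ?_⟩
  have hphi : ∀ m : Fin d → ℕ, ∏ i, phi ℓ (m i) (u i) = W * ψ m u := by
    intro m
    rw [hW, hψ, ← Finset.prod_mul_distrib]
    refine Finset.prod_congr rfl fun i _ => ?_
    rw [phi]; ring
  have hψsq : ∀ m : Fin d → ℕ, ψ m u ^ 2 = ∏ i, (u i ^ 2 / ℓ ^ 2) ^ m i / (m i).factorial := by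
    intro m
    rw [hψ, ← Finset.prod_pow]
    refine Finset.prod_congr rfl fun i _ => ?_
    rw [div_pow, mul_pow, Real.sq_sqrt (by positivity), div_pow, ← pow_mul, ← pow_mul, ← pow_mul,
      ← pow_mul, mul_comm 2, div_div]
  have hN0 : (0 : ℝ) < N := by linarith
  have htail : ∀ F : Finset (Fin d → ℕ), (∀ m ∈ F, m ∉ box) →
      ∑ m ∈ F, ψ m u ^ 2 ≤ (Real.exp (d * (ρ ^ 2 / ℓ ^ 2)) / N) ^ N := by
    intro F hF
    have hsum := hasSum_prod_pow_div_factorial fun i => N * (u i ^ 2 / ℓ ^ 2)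
    have hnn : ∀ m : Fin d → ℕ,
        0 ≤ ∏ i, (N * (u i ^ 2 / ℓ ^ 2)) ^ m i / ((m i).factorial : ℝ) :=
      fun m => Finset.prod_nonneg fun i _ => by positivity
    calc ∑ m ∈ F, ψ m u ^ 2
        ≤ ∑ m ∈ F, ((N : ℝ) ^ N)⁻¹ *
            ∏ i, (N * (u i ^ 2 / ℓ ^ 2)) ^ m i / ((m i).factorial : ℝ) := by
          refine Finset.sum_le_sum fun m hm => ?_
          have hbig : N ≤ ∑ i, m i := by
            have := hF m hm
            rw [hbox, Fintype.mem_piFinset] at this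
            push Not at this
            obtain ⟨i, hi⟩ := this
            have h1 : N ≤ m i := by
              rw [Finset.mem_range] at hi; omega
            exact h1.trans (Finset.single_le_sum (fun _ _ => Nat.zero_le _) (Finset.mem_univ i))
          have h2 : ∏ i, (N * (u i ^ 2 / ℓ ^ 2)) ^ m i / ((m i).factorial : ℝ) =
              (N : ℝ) ^ (∑ i, m i) * ψ m u ^ 2 := by
            rw [hψsq, ← Finset.prod_pow_eq_pow_sum, ← Finset.prod_mul_distrib]
            refine Finset.prod_congr rfl fun i _ => ?_
            rw [mul_pow, mul_div_assoc]
          rw [h2, ← mul_assoc]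
          refine le_mul_of_one_le_left (sq_nonneg _) ?_
          rw [← div_eq_inv_mul, one_le_div (by positivity)]
          exact pow_le_pow_right₀ hNR hbig
      _ = ((N : ℝ) ^ N)⁻¹ *
            ∑ m ∈ F, ∏ i, (N * (u i ^ 2 / ℓ ^ 2)) ^ m i / ((m i).factorial : ℝ) := by
          rw [Finset.mul_sum]
      _ ≤ ((N : ℝ) ^ N)⁻¹ * Real.exp (∑ i, N * (u i ^ 2 / ℓ ^ 2)) := by
          gcongr
          exact sum_le_hasSum F (fun m _ => hnn m) hsum
      _ ≤ ((N : ℝ) ^ N)⁻¹ * Real.exp (∑ _i : Fin d, N * (ρ ^ 2 / ℓ ^ 2)) := by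
          gcongr (_ * Real.exp (∑ i, _ * (?_ / _))) with i
          exact sq_le_sq' (abs_le.1 (hu i)).1 (abs_le.1 (hu i)).2
      _ = _ := by
          rw [div_pow, ← Real.exp_nat_mul, Finset.sum_const, Finset.card_univ, Fintype.card_fin,
            nsmul_eq_mul, inv_mul_eq_div, mul_left_comm]
  have hpart : ∀ F : Finset (Fin d → ℕ), box ⊆ F →
      |∑ m ∈ F, c m * ∏ i, phi ℓ (m i) (u i) - W * ∑ m ∈ box, c m * ψ m u| ≤
        W * Real.sqrt ((Real.exp (d * (ρ ^ 2 / ℓ ^ 2)) / N) ^ N) := by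
    intro F hF
    have h1 : ∑ m ∈ F, c m * ∏ i, phi ℓ (m i) (u i) - W * ∑ m ∈ box, c m * ψ m u =
        W * ∑ m ∈ F \ box, c m * ψ m u := by
      rw [← Finset.sum_sdiff hF]
      simp_rw [hphi, mul_left_comm _ W, ← Finset.mul_sum]
      ring
    rw [h1, abs_mul, abs_of_pos hW0]
    gcongr
    refine Real.abs_le_sqrt ?_
    refine (Finset.sum_mul_sq_le_sq_mul_sq _ _ _).trans ?_
    have h2 : ∑ m ∈ F \ box, c m ^ 2 ≤ 1 :=
      (hs.sum_le_tsum _ fun _ _ => sq_nonneg _).trans hle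
    have h3 := htail (F \ box) fun m hm => (Finset.mem_sdiff.1 hm).2
    calc _ ≤ 1 * ∑ m ∈ F \ box, ψ m u ^ 2 := by gcongr
      _ ≤ _ := by rwa [one_mul]
  have hlim : Tendsto (fun F : Finset (Fin d → ℕ) =>
      |∑ m ∈ F, c m * ∏ i, phi ℓ (m i) (u i) - W * ∑ m ∈ box, c m * ψ m u|) atTop
      (nhds |f u - W * ∑ m ∈ box, c m * ψ m u|) :=
    (Tendsto.sub_const (hc u) _).abs
  exact le_of_tendsto hlim (eventually_atTop.2 ⟨box, hpart⟩)

theorem exists_pow_le_exp_log_div {k G D : ℝ} (hk : 0 < k) (hG : 0 < G) (hD : 0 < D) :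
    ∃ C h₀ : ℝ, 0 < C ∧ 0 < h₀ ∧ ∀ h : ℝ, 0 < h → h ≤ h₀ → ∃ N : ℕ, 0 < N ∧ h * N ≤ k ∧
      D * Real.sqrt ((G / N) ^ N) ≤ Real.exp (C * Real.log h / h) := by
  set L₀ : ℝ := max (max 0 (2 * Real.log (2 / k))) (max (4 * Real.log G) (16 * Real.log D))
    with hL₀
  refine ⟨k / 32, min k (Real.exp (-L₀)), by positivity, by positivity, fun h hh hle => ?_⟩
  have hhk : h ≤ k := hle.trans (min_le_left _ _)
  have hL : L₀ ≤ -Real.log h := by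
    have := Real.log_le_log hh (hle.trans (min_le_right _ _))
    rw [Real.log_exp] at this
    linarith
  set L := -Real.log h with hLdef
  have hL1 : 0 ≤ L := ((le_max_left _ _).trans (le_max_left _ _)).trans hL
  have hL2 : 2 * Real.log (2 / k) ≤ L := ((le_max_right _ _).trans (le_max_left _ _)).trans hL
  have hL3 : 4 * Real.log G ≤ L := ((le_max_left _ _).trans (le_max_right _ _)).trans hL
  have hL4 : 16 * Real.log D ≤ L := ((le_max_right _ _).trans (le_max_right _ _)).trans hL
  have hkh : 1 ≤ k / h := (one_le_div hh).2 hhk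
  set N := ⌊k / h⌋₊ with hN
  have hN1 : 1 ≤ N := Nat.le_floor (by simpa using hkh)
  have hNR : (1 : ℝ) ≤ N := by exact_mod_cast hN1
  have hNle : (N : ℝ) ≤ k / h := Nat.floor_le (by positivity)
  have hNge : k / (2 * h) ≤ N := by
    have h1 : k / h < N + 1 := Nat.lt_floor_add_one _
    have h2 : k / (2 * h) = (k / h) / 2 := by field_simp
    rw [h2]; linarith
  have hN0 : (0 : ℝ) < N := by linarith
  refine ⟨N, hN1, ?_, ?_⟩
  · rw [le_div_iff₀ hh] at hNle; linarith
  have hlogN : L / 2 ≤ Real.log N := by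
    have h1 : Real.log (k / (2 * h)) = L - Real.log (2 / k) := by
      rw [hLdef, Real.log_div hk.ne' (by positivity), Real.log_mul two_ne_zero hh.ne',
        Real.log_div two_ne_zero hk.ne']
      ring
    have h2 := Real.log_le_log (by positivity) hNge
    linarith
  have hrw : D * Real.sqrt ((G / N) ^ N) =
      Real.exp (Real.log D + N * (Real.log G - Real.log N) / 2) := by
    rw [Real.exp_add, Real.exp_log hD]
    congr 1
    rw [← Real.log_div hG.ne' hN0.ne', ← Real.log_pow, Real.exp_half,
      Real.exp_log (by positivity)]
  rw [hrw, Real.exp_le_exp]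
  have h3 : k / 32 * Real.log h / h = -(k / (2 * h) * (L / 16)) := by
    rw [hLdef]; field_simp; ring
  rw [h3]
  have h4 : k / (2 * h) * (L / 16) ≤ N * (L / 16) := by gcongr
  nlinarith [mul_le_mul_of_nonneg_left hlogN hN0.le, mul_le_mul_of_nonneg_left hL3 hN0.le,
    mul_le_mul_of_nonneg_right hNR hL1]

theorem abs_sub_le_eucDist {d : ℕ} (x y : Fin d → ℝ) (i : Fin d) : |x i - y i| ≤ eucDist x y :=
  Real.abs_le_sqrt (Finset.single_le_sum (f := fun i => (x i - y i) ^ 2)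
    (fun _ _ => sq_nonneg _) (Finset.mem_univ i))

theorem exists_eucDist_eq_sInf {d : ℕ} {X : Finset (Fin d → ℝ)} {Ω : Set (Fin d → ℝ)}
    (hX : ∃ y ∈ X, y ∈ Ω) (x : Fin d → ℝ) :
    ∃ y ∈ X, y ∈ Ω ∧ sInf {r : ℝ | ∃ y ∈ X, y ∈ Ω ∧ r = eucDist x y} = eucDist x y := by
  have hfin : {r : ℝ | ∃ y ∈ X, y ∈ Ω ∧ r = eucDist x y}.Finite := by
    refine (X.finite_toSet.image (eucDist x)).subset ?_
    rintro r ⟨y, hy, _, rfl⟩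
    exact ⟨y, hy, rfl⟩
  obtain ⟨y₀, hy₀, hy₀'⟩ := hX
  have hne : {r : ℝ | ∃ y ∈ X, y ∈ Ω ∧ r = eucDist x y}.Nonempty :=
    ⟨eucDist x y₀, y₀, hy₀, hy₀', rfl⟩
  exact hne.csInf_mem hfin

theorem sInf_eucDist_le_fillDistD {d : ℕ} {X : Finset (Fin d → ℝ)} {a b : Fin d → ℝ}
    (hX : ∃ y ∈ X, y ∈ Set.Icc a b) {x : Fin d → ℝ} (hx : x ∈ Set.Icc a b) :
    sInf {r : ℝ | ∃ y ∈ X, y ∈ Set.Icc a b ∧ r = eucDist x y} ≤ fillDistD X (Set.Icc a b) := by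
  refine le_csSup ⟨Real.sqrt (∑ i, (b i - a i) ^ 2), ?_⟩ ⟨x, hx, rfl⟩
  rintro h ⟨z, hz, rfl⟩
  obtain ⟨y, -, hy, heq⟩ := exists_eucDist_eq_sInf hX z
  rw [heq]
  refine Real.sqrt_le_sqrt (Finset.sum_le_sum fun i _ => sq_le_sq' ?_ ?_)
  · linarith [hz.1 i, hy.2 i]
  · linarith [hz.2 i, hy.1 i]

theorem exists_eucDist_le_fillDistD {d : ℕ} {X : Finset (Fin d → ℝ)} {a b : Fin d → ℝ}
    (hX : ∃ y ∈ X, y ∈ Set.Icc a b) {x : Fin d → ℝ} (hx : x ∈ Set.Icc a b) :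
    ∃ y ∈ X, y ∈ Set.Icc a b ∧ eucDist x y ≤ fillDistD X (Set.Icc a b) := by
  obtain ⟨y, hyX, hy, heq⟩ := exists_eucDist_eq_sInf hX x
  exact ⟨y, hyX, hy, heq ▸ sInf_eucDist_le_fillDistD hX hx⟩

theorem fillDistD_pos {d : ℕ} (hd : 0 < d) {X : Finset (Fin d → ℝ)} {a b : Fin d → ℝ}
    (hab : ∀ i, a i < b i) (hX : ∃ y ∈ X, y ∈ Set.Icc a b) : 0 < fillDistD X (Set.Icc a b) := by
  have : Nonempty (Fin d) := ⟨⟨0, hd⟩⟩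
  have hinf : (Set.Icc a b).Infinite := Set.Icc_infinite (Pi.lt_def.2
    ⟨fun i => (hab i).le, ⟨0, hd⟩, hab _⟩)
  obtain ⟨x, hx, hxX⟩ := hinf.exists_notMem_finset X
  obtain ⟨y, hyX, -, hle⟩ := exists_eucDist_le_fillDistD hX hx
  refine lt_of_lt_of_le (Real.sqrt_pos.2 ?_) hle
  refine lt_of_le_of_ne (Finset.sum_nonneg fun i _ => sq_nonneg _) fun h => hxX ?_
  have h0 := (Finset.sum_eq_zero_iff_of_nonneg fun i _ => sq_nonneg (x i - y i)).1 h.symm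
  have : x = y := funext fun i => by
    have := h0 i (Finset.mem_univ i)
    rwa [sq_eq_zero_iff, sub_eq_zero] at this
  rwa [this]

theorem IsCoordPoly.comp_smul {d N : ℕ} {p : (Fin d → ℝ) → ℝ} (hp : IsCoordPoly N p) (ρ : ℝ) :
    IsCoordPoly N fun v => p (ρ • v) := by
  intro i x
  obtain ⟨P, hP, hPe⟩ := hp i (ρ • x)
  refine ⟨P.comp (Polynomial.C ρ * Polynomial.X), ?_, fun t => ?_⟩
  · refine Polynomial.natDegree_comp_le.trans ?_
    calc P.natDegree * (Polynomial.C ρ * Polynomial.X).natDegree ≤ P.natDegree * 1 :=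
          Nat.mul_le_mul_left _
            ((Polynomial.natDegree_C_mul_le _ _).trans Polynomial.natDegree_X_le)
      _ ≤ N := by simpa using hP
  · have : ρ • Function.update x i t = Function.update (ρ • x) i (ρ * t) := by
      ext j
      rcases eq_or_ne j i with rfl | h <;> simp [*]
    beta_reduce
    rw [this, hPe]
    simp

/-- Functions in the unit ball vanishing at points of density comparable to `1/N` are
super-exponentially small in `N`. -/
theorem exists_abs_le_of_vanish (d : ℕ) {ℓ ρ : ℝ} (hℓ : 0 < ℓ) (hρ : 0 < ρ) :
    ∃ k : ℝ, 0 < k ∧ ∀ (a : Fin d → ℝ) (X : Finset (Fin d → ℝ)) (h : ℝ) (N : ℕ),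
      0 < N → h * N ≤ k →
      (∀ x : Fin d → ℝ, (∀ i, |x i - a i| ≤ ρ) →
        ∃ y ∈ X, (∀ i, |y i - a i| ≤ ρ) ∧ ∀ i, |x i - y i| ≤ h) →
      ∀ f, InBallD (fun _ => ℓ) f → (∀ y ∈ X, f y = 0) →
      ∀ x : Fin d → ℝ, (∀ i, |x i - a i| ≤ ρ) →
        |f x| ≤ 3 * (7 ^ d) ^ N * Real.sqrt ((Real.exp (d * (ρ ^ 2 / ℓ ^ 2)) / N) ^ N) := by
  obtain ⟨c, hc, hnorm⟩ := exists_norming_constant d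
  refine ⟨c * ρ, by positivity, ?_⟩
  intro a X h N hN hhN hX f hf hfX x hx
  obtain ⟨g, hg, hgf⟩ := hf.exists_translate hℓ (insert x X) a
  obtain ⟨p, hp, hpc, happ⟩ := hg.exists_coordPoly_approx hℓ (ρ := ρ) hN
  set T := Real.sqrt ((Real.exp (d * (ρ ^ 2 / ℓ ^ 2)) / N) ^ N) with hT
  have hT0 : 0 ≤ T := Real.sqrt_nonneg _
  set Y : Set (Fin d → ℝ) := {v | (∀ i, |v i| ≤ 1) ∧ ρ • v + a ∈ X} with hY
  have hscale : ∀ (v : Fin d → ℝ) i, |v i| ≤ 1 → |(ρ • v) i| ≤ ρ := by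
    intro v i hv
    rw [Pi.smul_apply, smul_eq_mul, abs_mul, abs_of_pos hρ]
    nlinarith
  have hpY : ∀ v ∈ Y, |p (ρ • v)| ≤ T := by
    rintro v ⟨hv, hvX⟩
    obtain ⟨W, hW0, -, hW⟩ := happ (ρ • v) fun i => hscale v i (hv i)
    have h0 : g (ρ • v) = 0 := by
      have := hgf _ (Finset.mem_insert_of_mem hvX)
      rwa [add_sub_cancel_right, hfX _ hvX] at this
    rw [h0, zero_sub, abs_neg, abs_mul, abs_of_pos hW0] at hW
    exact le_of_mul_le_mul_left hW hW0
  have hdense : ∀ v : Fin d → ℝ, (∀ i, |v i| ≤ 1) → ∃ y ∈ Y, ∀ i, |v i - y i| ≤ h / ρ := by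
    intro v hv
    obtain ⟨y, hyX, hya, hy⟩ := hX (ρ • v + a) fun i => by
      rw [Pi.add_apply, add_sub_cancel_right]; exact hscale v i (hv i)
    refine ⟨ρ⁻¹ • (y - a), ⟨fun i => ?_, ?_⟩, fun i => ?_⟩
    · rw [Pi.smul_apply, smul_eq_mul, abs_mul, abs_of_pos (inv_pos.2 hρ), inv_mul_le_one₀ hρ]
      exact hya i
    · rwa [smul_inv_smul₀ hρ.ne', sub_add_cancel]
    · have h1 : v i - (ρ⁻¹ • (y - a)) i = ((ρ • v + a) i - y i) / ρ := by
        simp only [Pi.smul_apply, Pi.sub_apply, Pi.add_apply, smul_eq_mul]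
        field_simp
        ring
      rw [h1, abs_div, abs_of_pos hρ]
      gcongr
      exact hy i
  have hδ : h / ρ * N ≤ c := by
    rw [div_mul_eq_mul_div, div_le_iff₀ hρ]; exact hhN
  have hpx := hnorm N (fun v => p (ρ • v)) Y (h / ρ) T hN (hp.comp_smul ρ) (by fun_prop) hδ
    hdense hpY (ρ⁻¹ • (x - a)) fun i => by
      rw [Pi.smul_apply, smul_eq_mul, abs_mul, abs_of_pos (inv_pos.2 hρ), inv_mul_le_one₀ hρ]
      exact hx i
  simp only [smul_inv_smul₀ hρ.ne'] at hpx
  obtain ⟨W, hW0, hW1, hW⟩ := happ (x - a) hx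
  rw [← hgf x (Finset.mem_insert_self _ _)]
  have h7 : (1 : ℝ) ≤ (7 ^ d) ^ N := one_le_pow₀ (one_le_pow₀ (by norm_num))
  have h2 := abs_sub_abs_le_abs_sub (g (x - a)) (W * p (x - a))
  rw [abs_mul, abs_of_pos hW0] at h2
  have h3 : W * |p (x - a)| ≤ |p (x - a)| := mul_le_of_le_one_left (abs_nonneg _) hW1
  have h4 : W * T ≤ T := mul_le_of_le_one_left hT0 hW1
  nlinarith

/-- sampling inequality on cubes for the L¹-norm of the power function of the
isotropic Gaussian kernel. -/
theorem stmt13 (d : ℕ) (hd : 0 < d) (ℓ R : ℝ) (hℓ : 0 < ℓ) (hR : 0 < R) :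
    ∃ C h₀ : ℝ, 0 < C ∧ 0 < h₀ ∧
      ∀ (a : Fin d → ℝ) (X : Finset (Fin d → ℝ)),
        (∃ y ∈ X, y ∈ Set.Icc a (fun i => a i + R)) →
        fillDistD X (Set.Icc a (fun i => a i + R)) ≤ h₀ →
        (∫ x in Set.Icc a (fun i => a i + R), powerD ℓ X x)
          ≤ Real.exp (C * Real.log (fillDistD X (Set.Icc a (fun i => a i + R))) /
              fillDistD X (Set.Icc a (fun i => a i + R))) := by
  have hρ : 0 < R / 2 := by positivity
  obtain ⟨k, hk, hbound⟩ := exists_abs_le_of_vanish d hℓ hρ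
  set E := Real.exp (d * ((R / 2) ^ 2 / ℓ ^ 2)) with hE
  obtain ⟨C, h₀, hC, hh₀, hdecay⟩ := exists_pow_le_exp_log_div hk
    (G := (7 ^ d) ^ 2 * E) (D := 3 * R ^ d) (by positivity) (by positivity)
  refine ⟨C, h₀, hC, hh₀, fun a X hX hle => ?_⟩
  set Ω := Set.Icc a (fun i => a i + R) with hΩ
  set h := fillDistD X Ω with hh
  have hpos : 0 < h := fillDistD_pos hd (fun i => by linarith) hX
  obtain ⟨N, hN, hNk, hexp⟩ := hdecay h hpos hle
  have hmem : ∀ x : Fin d → ℝ, x ∈ Ω ↔ ∀ i, |x i - (a i + R / 2)| ≤ R / 2 := by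
    intro x
    simp only [hΩ, Set.mem_Icc, Pi.le_def, abs_le]
    refine ⟨fun hx i => ⟨?_, ?_⟩, fun hx => ⟨fun i => ?_, fun i => ?_⟩⟩
    · linarith [hx.1 i]
    · linarith [hx.2 i]
    · linarith [(hx i).1]
    · linarith [(hx i).2]
  set B := 3 * (7 ^ d) ^ N * Real.sqrt ((E / N) ^ N) with hB
  have hf : ∀ f, InBallD (fun _ => ℓ) f → (∀ y ∈ X, f y = 0) → ∀ x ∈ Ω, |f x| ≤ B := by
    intro f hf hfX x hx
    refine hbound (fun i => a i + R / 2) X h N hN hNk (fun z hz => ?_) f hf hfX x ((hmem x).1 hx)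
    obtain ⟨y, hyX, hy, hzy⟩ := exists_eucDist_le_fillDistD hX ((hmem z).2 hz)
    exact ⟨y, hyX, (hmem y).1 hy, fun i => (abs_sub_le_eucDist z y i).trans hzy⟩
  have hB0 : 0 ≤ B := by positivity
  have hpow : ∀ x ∈ Ω, ‖powerD ℓ X x‖ ≤ B := by
    intro x hx
    have hub : ∀ v ∈ {v : ℝ | ∃ f, InBallD (fun _ => ℓ) f ∧ (∀ y ∈ X, f y = 0) ∧ v = f x},
        |v| ≤ B := by
      rintro v ⟨f, hfb, hfX, rfl⟩
      exact hf f hfb hfX x hx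
    have h0 : InBallD (fun _ : Fin d => ℓ) (fun _ => 0) :=
      ⟨fun _ => 0, fun _ => by simp, by simp, by simp⟩
    have hnn : 0 ≤ powerD ℓ X x :=
      le_csSup ⟨B, fun v hv => (le_abs_self v).trans (hub v hv)⟩
        ⟨fun _ => 0, h0, fun _ _ => rfl, rfl⟩
    rw [Real.norm_of_nonneg hnn]
    exact Real.sSup_le (fun v hv => (le_abs_self v).trans (hub v hv)) hB0
  have hvol : (volume : Measure (Fin d → ℝ)).real Ω = R ^ d := by
    rw [Measure.real, hΩ, Real.volume_Icc_pi_toReal (fun i => by simpa using hR.le)]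
    simp
  have hfin : (volume : Measure (Fin d → ℝ)) Ω < ⊤ := isCompact_Icc.measure_lt_top
  calc (∫ x in Ω, powerD ℓ X x) ≤ ‖∫ x in Ω, powerD ℓ X x‖ := Real.le_norm_self _
    _ ≤ B * R ^ d := by
        rw [← hvol]; exact norm_setIntegral_le_of_norm_le_const hfin hpow
    _ = 3 * R ^ d * Real.sqrt (((7 ^ d) ^ 2 * E / N) ^ N) := by
        have hswap : (((7 : ℝ) ^ d) ^ 2) ^ N = ((7 ^ d) ^ N) ^ 2 := pow_right_comm _ _ _
        rw [hB, mul_div_assoc, mul_pow, hswap, Real.sqrt_mul (by positivity),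
          Real.sqrt_sq (by positivity)]
        ring
    _ ≤ _ := hexp

end
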